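/- Let r ≥ 2, let N ≥ 2 with (r−1) dividing (N−1), and let p_1 ≤ p_2 ≤ ... ≤ p_N be strictly positive real numbers. Define H(0) = 0 and, for 0 < i ≤ (N−1)/(r−1), H(i) = min_{max(0, ri−N) ≤ j < i} ( H(j) + S_{ri−j} ). Then H((N−1)/(r−1)) equals the minimum, over all prefix-free codes w of size N over an alphabet with r letters, of the cost sum_{i=1}^N p_i·|w_i| (i.e., it is the cost of an optimal r-ary Huffman code). -/

import Mathlib

open scoped ENNReal

/-- Prefix sum `S_m = p_1 + ... + p_m`, viewed in `[0,∞]`. -/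
noncomputable def prefSum (p : ℕ → ℝ) (m : ℕ) : ℝ≥0∞ :=
  ENNReal.ofReal (∑ i ∈ Finset.Icc 1 m, p i)

/-- The unrestricted `r`-ary Huffman DP: `H(0) = 0` and, for `i > 0`,
`H(i) = min_{max(0, ri-N) ≤ j < i} (H(j) + S_{ri-j})`. -/
noncomputable def huffH (N r : ℕ) (p : ℕ → ℝ) : ℕ → ℝ≥0∞
  | 0 => 0
  | i + 1 =>
      (Finset.range (i + 1)).attach.inf fun j =>
        if r * (i + 1) - N ≤ j.1 then
          huffH N r p j.1 + prefSum p (r * (i + 1) - j.1)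
        else ⊤
  decreasing_by exact Finset.mem_range.mp j.2


lemma aux_prefSum (N : ℕ) (p : ℕ → ℝ)
    (hmono : ∀ i j, 1 ≤ i → i ≤ j → j ≤ N → p i ≤ p j) :
    ∀ (m : ℕ) (T : Finset ℕ), T ⊆ Finset.Icc 1 N → T.card = m →
      ∑ i ∈ Finset.Icc 1 m, p i ≤ ∑ i ∈ T, p i := by
  intro m
  induction m with
  | zero => intro T hT hc; rw [Finset.card_eq_zero] at hc; simp [hc]
  | succ m ih =>
    intro T hT hc
    have hne : T.Nonempty := Finset.card_pos.mp (by omega)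
    have hM := T.max'_mem hne
    set M := T.max' hne with hMdef
    have hMN := Finset.mem_Icc.mp (hT hM)
    have hsub : T ⊆ Finset.Icc 1 M := by
      intro x hx
      exact Finset.mem_Icc.mpr ⟨(Finset.mem_Icc.mp (hT hx)).1, T.le_max' x hx⟩
    have h1 := Finset.card_le_card hsub
    rw [hc, Nat.card_Icc] at h1
    have h2 := ih (T.erase M) ((Finset.erase_subset _ _).trans hT)
      (by rw [Finset.card_erase_of_mem hM, hc]; rfl)
    rw [Finset.sum_Icc_succ_top (by omega), ← Finset.sum_erase_add _ _ hM]
    exact add_le_add h2 (hmono _ _ (by omega) (by omega) hMN.2)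

lemma aux_kraft_conv (r : ℕ) (hr : 2 ≤ r) (α : Type) [Fintype α] (hcard : Fintype.card α = r)
    (l : ℕ → ℕ) (s : Finset ℕ) : (∑ i ∈ s, (1 / (r : ℝ)) ^ l i ≤ 1) →
    ∃ w : ℕ → List α, (∀ i ∈ s, (w i).length = l i) ∧
      ∀ i ∈ s, ∀ j ∈ s, i ≠ j → ¬ w i <+: w j := by
  classical
  have hr0 : (0 : ℝ) < r := by exact_mod_cast (by omega : 0 < r)
  induction s using Finset.induction_on_max_value l with
  | empty => intro _; exact ⟨fun _ => [], by simp, by simp⟩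
  | insert a s ha hmax ih =>
    intro hk
    rw [Finset.sum_insert ha] at hk
    obtain ⟨w, hw, hp⟩ := ih (by have : 0 < (1 / (r : ℝ)) ^ l a := by positivity
                                 linarith)
    let B : Finset (List α) := s.biUnion fun j =>
      (Finset.univ : Finset (List.Vector α (l a - l j))).image fun u => w j ++ u.1
    let A : Finset (List α) := (Finset.univ : Finset (List.Vector α (l a))).image fun u => u.1
    have hA : A.card = r ^ l a := by
      rw [show A.card = _ from Finset.card_image_of_injective _ Subtype.val_injective,
        Finset.card_univ, card_vector,
        hcard]
    have hB : B.card ≤ ∑ j ∈ s, r ^ (l a - l j) := by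
      refine Finset.card_biUnion_le.trans (Finset.sum_le_sum fun j _ => ?_)
      refine Finset.card_image_le.trans ?_
      rw [Finset.card_univ, card_vector, hcard]
    have hlt : ∑ j ∈ s, r ^ (l a - l j) < r ^ l a := by
      have h1 : ((∑ j ∈ s, r ^ (l a - l j) : ℕ) : ℝ) = r ^ l a * ∑ j ∈ s, (1 / (r : ℝ)) ^ l j := by
        push_cast
        rw [Finset.mul_sum]
        refine Finset.sum_congr rfl fun j hj => ?_
        rw [pow_sub₀ _ hr0.ne' (hmax j hj), one_div, inv_pow]
      have h2 : (r : ℝ) ^ l a * (1 / (r : ℝ)) ^ l a = 1 := by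
        rw [← mul_pow, mul_one_div_cancel hr0.ne', one_pow]
      have h3 : ((∑ j ∈ s, r ^ (l a - l j) : ℕ) : ℝ) < ((r ^ l a : ℕ) : ℝ) := by
        rw [h1]
        push_cast
        have : (0 : ℝ) < r ^ l a := by positivity
        nlinarith
      exact_mod_cast h3
    obtain ⟨v, hvA, hvB⟩ := Finset.exists_mem_notMem_of_card_lt_card
      (show B.card < A.card by omega)
    have hvl : v.length = l a := by
      obtain ⟨u, -, rfl⟩ := Finset.mem_image.mp hvA
      exact u.2
    have hnp : ∀ j ∈ s, ¬ w j <+: v := by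
      rintro j hj ⟨t, ht⟩
      apply hvB
      refine Finset.mem_biUnion.mpr ⟨j, hj, Finset.mem_image.mpr ⟨⟨t, ?_⟩, Finset.mem_univ _, ht⟩⟩
      have := congrArg List.length ht
      rw [List.length_append, hw j hj, hvl] at this
      omega
    refine ⟨Function.update w a v, ?_, ?_⟩
    · intro i hi
      rcases Finset.mem_insert.mp hi with rfl | hi'
      · simpa using hvl
      · rw [Function.update_of_ne (by rintro rfl; exact ha hi')]
        exact hw i hi'
    · intro i hi j hj hij
      rcases Finset.mem_insert.mp hi with rfl | hi'
      · rcases Finset.mem_insert.mp hj with rfl | hj'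
        · exact absurd rfl hij
        · rw [Function.update_self, Function.update_of_ne hij.symm]
          intro hpre
          have h1 := hpre.length_le
          have h2 := hmax j hj'
          rw [hvl, hw j hj'] at h1
          have h3 := hpre.eq_of_length (by rw [hvl, hw j hj']; omega)
          exact hnp j hj' (by rw [h3])
      · rcases Finset.mem_insert.mp hj with rfl | hj'
        · rw [Function.update_self, Function.update_of_ne hij]
          exact hnp i hi'
        · rw [Function.update_of_ne (by rintro rfl; exact ha hi'),
            Function.update_of_ne (by rintro rfl; exact ha hj')]
          exact hp i hi' j hj' hij

lemma aux_ud {α : Type} (S : Set (List α)) (hne : [] ∉ S)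
    (hp : ∀ u ∈ S, ∀ v ∈ S, u <+: v → u = v) : InformationTheory.UniquelyDecodable S := by
  intro L₁
  induction L₁ with
  | nil =>
    intro L₂ _ h2 he
    cases L₂ with
    | nil => rfl
    | cons v L =>
      exfalso
      have hv : v = [] := by
        simp only [List.flatten_nil, List.flatten_cons] at he
        exact (List.append_eq_nil_iff.mp he.symm).1
      exact hne (hv ▸ h2 v (by simp))
  | cons u L ih =>
    intro L₂ h1 h2 he
    cases L₂ with
    | nil =>
      exfalso
      have hv : u = [] := by
        simp only [List.flatten_nil, List.flatten_cons] at he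
        exact (List.append_eq_nil_iff.mp he).1
      exact hne (hv ▸ h1 u (by simp))
    | cons v L' =>
      simp only [List.flatten_cons] at he
      have hu := h1 u (by simp)
      have hv := h2 v (by simp)
      have huv : u = v := by
        rcases List.prefix_or_prefix_of_prefix (List.prefix_append u L.flatten)
          (he ▸ List.prefix_append v L'.flatten) with h | h
        · exact hp u hu v hv h
        · exact (hp v hv u hu h).symm
      subst huv
      have := ih L' (fun w hw => h1 w (by simp [hw])) (fun w hw => h2 w (by simp [hw]))
        (List.append_cancel_left he)
      rw [this]

lemma aux_kraft (N r : ℕ) (hr : 2 ≤ r) (hN : 2 ≤ N) (α : Type) [Fintype α]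
    (hcard : Fintype.card α = r) (w : ℕ → List α)
    (hw : ∀ i ∈ Finset.Icc 1 N, ∀ j ∈ Finset.Icc 1 N, i ≠ j → ¬ w i <+: w j) :
    ∑ i ∈ Finset.Icc 1 N, (1 / (r : ℝ)) ^ (w i).length ≤ 1 := by
  classical
  have : Nonempty α := Fintype.card_pos_iff.mp (by omega)
  have hinj : Set.InjOn w (Finset.Icc 1 N : Finset ℕ) := by
    intro i hi j hj hij
    by_contra hne
    exact hw i hi j hj hne (by rw [hij])
  have := InformationTheory.kraft_mcmillan_inequality (α := α) (S := (Finset.Icc 1 N).image w) (by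
    apply aux_ud
    · intro h
      obtain ⟨i, hi, h0⟩ := Finset.mem_image.mp (Finset.mem_coe.mp h)
      have hex : ∃ j ∈ Finset.Icc 1 N, i ≠ j := by
        by_cases h1 : i = 1
        · exact ⟨2, Finset.mem_Icc.mpr ⟨by omega, hN⟩, by omega⟩
        · exact ⟨1, Finset.mem_Icc.mpr ⟨by omega, by omega⟩, h1⟩
      obtain ⟨j, hj, hij⟩ := hex
      exact hw i hi j hj hij (by rw [h0]; exact List.nil_prefix)
    · intro u hu v hv huv
      obtain ⟨i, hi, rfl⟩ := Finset.mem_image.mp (Finset.mem_coe.mp hu)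
      obtain ⟨j, hj, rfl⟩ := Finset.mem_image.mp (Finset.mem_coe.mp hv)
      by_contra hne
      exact hw i hi j hj (fun h => hne (by rw [h])) huv)
  rw [Finset.sum_image hinj, hcard] at this
  exact this

lemma aux_huffH_le (N r : ℕ) (p : ℕ → ℝ) (i j : ℕ) (hj : j < i) (h : r * i - N ≤ j) :
    huffH N r p i ≤ huffH N r p j + prefSum p (r * i - j) := by
  cases i with
  | zero => omega
  | succ i =>
    rw [huffH]
    refine (Finset.inf_le (Finset.mem_attach _ ⟨j, Finset.mem_range.mpr hj⟩)).trans ?_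
    simp [h]

lemma aux_huffH_ex (N r : ℕ) (p : ℕ → ℝ) (i : ℕ) (hi : 0 < i) (hne : huffH N r p i ≠ ⊤) :
    ∃ j < i, r * i - N ≤ j ∧ huffH N r p i = huffH N r p j + prefSum p (r * i - j) := by
  cases i with
  | zero => omega
  | succ i =>
    rw [huffH] at hne ⊢
    obtain ⟨j, -, hj⟩ := Finset.exists_mem_eq_inf (Finset.range (i + 1)).attach
      (by simp) (fun j => if r * (i + 1) - N ≤ j.1 then
          huffH N r p j.1 + prefSum p (r * (i + 1) - j.1) else ⊤)
    rw [hj] at hne ⊢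
    by_cases hc : r * (i + 1) - N ≤ j.1
    · exact ⟨j.1, Finset.mem_range.mp j.2, hc, by simp [hc]⟩
    · simp [hc] at hne

lemma aux_upper (N r : ℕ) (hr : 2 ≤ r) (p : ℕ → ℝ)
    (hpos : ∀ i, 1 ≤ i → i ≤ N → 0 < p i) (i : ℕ) : huffH N r p i ≠ ⊤ →
    ∃ l : ℕ → ℕ, ∑ k ∈ Finset.Icc 1 N, ENNReal.ofReal (p k) * (l k : ℝ≥0∞) = huffH N r p i ∧
      ∑ k ∈ Finset.Icc 1 N, (1 / (r : ℝ)) ^ l k ≤ N - ((r : ℝ) - 1) * i := by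
  have hr0 : (2 : ℝ) ≤ r := by exact_mod_cast hr
  induction i using Nat.strong_induction_on with
  | _ i ih =>
  intro hne
  rcases Nat.eq_zero_or_pos i with rfl | hi
  · exact ⟨fun _ => 0, by simp [huffH], by simp⟩
  obtain ⟨j, hj, hc, he⟩ := aux_huffH_ex N r p i hi hne
  rw [he] at hne ⊢
  obtain ⟨l, hl, hk⟩ := ih j hj (fun h => hne (by simp [h]))
  have hji : j ≤ r * i := by nlinarith
  set m := r * i - j with hm
  have hmN : m ≤ N := by omega
  have hmR : (m : ℝ) = r * i - j := by rw [hm, Nat.cast_sub hji]; push_cast; ring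
  have hfil : (Finset.Icc 1 N).filter (· ≤ m) = Finset.Icc 1 m := by
    ext x; simp only [Finset.mem_filter, Finset.mem_Icc]; omega
  refine ⟨fun k => l k + if k ≤ m then 1 else 0, ?_, ?_⟩
  · rw [← hl, prefSum, ENNReal.ofReal_sum_of_nonneg, ← hfil, Finset.sum_filter,
      ← Finset.sum_add_distrib]
    · refine Finset.sum_congr rfl fun k _ => ?_
      push_cast
      split_ifs <;> simp [mul_add]
    · intro k hk
      rw [Finset.mem_Icc] at hk
      exact (hpos k hk.1 (by omega)).le
  · have hterm : ∀ k ∈ Finset.Icc 1 N, (1 / (r : ℝ)) ^ (l k + if k ≤ m then 1 else 0) ≤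
        (1 / (r : ℝ)) * (1 / (r : ℝ)) ^ l k + (1 - 1 / r) * (1 - if k ≤ m then 1 else 0) := by
      intro k _
      split_ifs
      · rw [pow_succ]; apply le_of_eq; ring
      · have h1 : (1 / (r : ℝ)) ^ l k ≤ 1 :=
          pow_le_one₀ (by positivity) (by rw [div_le_one (by linarith)]; linarith)
        have h2 : 1 / (r : ℝ) ≤ 1 := by rw [div_le_one (by linarith)]; linarith
        simp only [add_zero]
        nlinarith
    refine (Finset.sum_le_sum hterm).trans ?_
    rw [Finset.sum_add_distrib, ← Finset.mul_sum, ← Finset.mul_sum, Finset.sum_sub_distrib,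
      ← Finset.sum_filter, hfil]
    simp only [Finset.sum_const, Nat.card_Icc, nsmul_eq_mul, mul_one, Nat.add_sub_cancel]
    have h3 : 1 / (r : ℝ) * ∑ k ∈ Finset.Icc 1 N, (1 / (r : ℝ)) ^ l k ≤
      1 / (r : ℝ) * (N - ((r : ℝ) - 1) * j) := mul_le_mul_of_nonneg_left hk (by positivity)
    refine (add_le_add_left h3 _).trans (le_of_eq ?_)
    rw [hmR]
    have : (r : ℝ) ≠ 0 := by linarith
    field_simp
    ring

lemma aux_lower (N r : ℕ) (hr : 2 ≤ r) (p : ℕ → ℝ)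
    (hpos : ∀ i, 1 ≤ i → i ≤ N → 0 < p i)
    (hmono : ∀ i j, 1 ≤ i → i ≤ j → j ≤ N → p i ≤ p j) (i : ℕ) : ∀ l : ℕ → ℕ,
    ∑ k ∈ Finset.Icc 1 N, (1 / (r : ℝ)) ^ l k ≤ N - ((r : ℝ) - 1) * i →
    huffH N r p i ≤ ∑ k ∈ Finset.Icc 1 N, ENNReal.ofReal (p k) * (l k : ℝ≥0∞) := by
  have hr0 : (2 : ℝ) ≤ r := by exact_mod_cast hr
  induction i using Nat.strong_induction_on with
  | _ i ih =>
  intro l hk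
  rcases Nat.eq_zero_or_pos i with rfl | hi
  · simp [huffH]
  set T := (Finset.Icc 1 N).filter (fun k => 1 ≤ l k) with hT
  have hTs : T ⊆ Finset.Icc 1 N := Finset.filter_subset _ _
  set m := T.card with hm
  have hmN : m ≤ N := by simpa using Finset.card_le_card hTs
  have hiR : (0 : ℝ) < i := by exact_mod_cast hi
  -- the stripped Kraft sum
  have hstrip : ∑ k ∈ Finset.Icc 1 N, (1 / (r : ℝ)) ^ (l k - 1) =
      r * (∑ k ∈ Finset.Icc 1 N, (1 / (r : ℝ)) ^ l k) - (r - 1) * (N - m) := by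
    have : ∀ k ∈ Finset.Icc 1 N, (1 / (r : ℝ)) ^ (l k - 1) =
        r * (1 / (r : ℝ)) ^ l k - (r - 1) * (1 - if 1 ≤ l k then 1 else 0) := by
      intro k _
      split_ifs with h
      · obtain ⟨t, ht⟩ := Nat.exists_eq_add_of_le' h
        rw [ht, Nat.add_sub_cancel, pow_succ]
        field_simp
        ring
      · have : l k = 0 := by omega
        simp [this]
    rw [Finset.sum_congr rfl this, Finset.sum_sub_distrib, ← Finset.mul_sum, ← Finset.mul_sum,
      Finset.sum_sub_distrib, ← Finset.sum_filter, ← hT]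
    simp [hm]
  have hstrip0 : 0 ≤ ∑ k ∈ Finset.Icc 1 N, (1 / (r : ℝ)) ^ (l k - 1) :=
    Finset.sum_nonneg fun k _ => by positivity
  have hcost : ∑ k ∈ Finset.Icc 1 N, ENNReal.ofReal (p k) * ((l k - 1 : ℕ) : ℝ≥0∞) + prefSum p m ≤
      ∑ k ∈ Finset.Icc 1 N, ENNReal.ofReal (p k) * (l k : ℝ≥0∞) := by
    have h1 : prefSum p m ≤ ∑ k ∈ T, ENNReal.ofReal (p k) := by
      rw [prefSum, ← ENNReal.ofReal_sum_of_nonneg]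
      · exact ENNReal.ofReal_le_ofReal (aux_prefSum N p hmono m T hTs rfl)
      · intro k hk
        have := Finset.mem_Icc.mp (hTs hk)
        exact (hpos k this.1 this.2).le
    refine (add_le_add_right h1 _).trans (le_of_eq ?_)
    rw [hT, Finset.sum_filter, ← Finset.sum_add_distrib]
    refine Finset.sum_congr rfl fun k _ => ?_
    split_ifs with h
    · obtain ⟨t, ht⟩ := Nat.exists_eq_add_of_le' h
      rw [ht, Nat.add_sub_cancel]
      push_cast
      ring
    · have : l k = 0 := by omega
      simp [this]
  refine le_trans ?_ hcost
  -- m > (r-1) i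
  have hmi : r * i < m + i := by
    have h1 : ((N : ℝ) - m) < ∑ k ∈ Finset.Icc 1 N, (1 / (r : ℝ)) ^ l k ∨ m = N := by
      by_cases hmN' : m = N
      · exact Or.inr hmN'
      left
      have hm0 : 0 < m := by
        rw [hm, Finset.card_pos]
        by_contra hem
        rw [Finset.not_nonempty_iff_eq_empty] at hem
        have : ∀ k ∈ Finset.Icc 1 N, (1 / (r : ℝ)) ^ l k = 1 := by
          intro k hk
          have : l k = 0 := by
            by_contra h0
            have : k ∈ T := Finset.mem_filter.mpr ⟨hk, by omega⟩
            simp [hem] at this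
          simp [this]
        rw [Finset.sum_congr rfl this] at hk
        simp at hk
        nlinarith
      obtain ⟨k0, hk0⟩ := Finset.card_pos.mp hm0
      have hlt : ∑ k ∈ Finset.Icc 1 N, (1 - if 1 ≤ l k then (1 : ℝ) else 0) <
          ∑ k ∈ Finset.Icc 1 N, (1 / (r : ℝ)) ^ l k := by
        refine Finset.sum_lt_sum (fun k _ => ?_) ⟨k0, hTs hk0, ?_⟩
        · split_ifs with h
          · simp only [sub_self]; positivity
          · have : l k = 0 := by omega
            simp [this]
        · rw [if_pos (Finset.mem_filter.mp hk0).2, sub_self]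
          positivity
      rw [Finset.sum_sub_distrib, ← Finset.sum_filter, ← hT] at hlt
      simpa [hm] using hlt
    have h2 : ((r : ℝ) - 1) * i < m := by
      rcases h1 with h1 | h1
      · linarith
      · rcases Nat.eq_zero_or_pos N with h0 | h0
        · subst h0
          simp at hk
          nlinarith
        · have : 0 < ∑ k ∈ Finset.Icc 1 N, (1 / (r : ℝ)) ^ l k :=
            Finset.sum_pos (fun k _ => by positivity) ⟨1, Finset.mem_Icc.mpr ⟨le_rfl, h0⟩⟩
          rw [h1]
          linarith
    have h3 : ((r * i : ℕ) : ℝ) < ((m + i : ℕ) : ℝ) := by push_cast; linarith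
    exact_mod_cast h3
  by_cases hcase : m ≤ r * i
  · have h1 := aux_huffH_le N r p i (r * i - m) (by omega) (by omega)
    rw [Nat.sub_sub_self hcase] at h1
    refine h1.trans (add_le_add_left (ih (r * i - m) (by omega) (fun k => l k - 1) ?_) _)
    rw [hstrip, Nat.cast_sub hcase]
    push_cast
    nlinarith
  · have h1 := aux_huffH_le N r p i 0 hi (by omega)
    refine h1.trans ?_
    rw [huffH, zero_add, Nat.sub_zero]
    refine le_trans ?_ le_add_self
    refine ENNReal.ofReal_le_ofReal (Finset.sum_le_sum_of_subset_of_nonneg ?_ ?_)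
    · exact Finset.Icc_subset_Icc le_rfl (by omega)
    · intro k hk _
      have := Finset.mem_Icc.mp hk
      exact (hpos k this.1 (by omega)).le


theorem stmt_17 (N r : ℕ) (hr : 2 ≤ r) (hN : 2 ≤ N) (hdvd : (r - 1) ∣ (N - 1))
    (p : ℕ → ℝ)
    (hpos : ∀ i, 1 ≤ i → i ≤ N → 0 < p i)
    (hmono : ∀ i j, 1 ≤ i → i ≤ j → j ≤ N → p i ≤ p j)
    (α : Type) [Fintype α] (hcard : Fintype.card α = r) :
    huffH N r p ((N - 1) / (r - 1)) =
      ⨅ (w : ℕ → List α)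
        (_ : ∀ i ∈ Finset.Icc 1 N, ∀ j ∈ Finset.Icc 1 N, i ≠ j → ¬ w i <+: w j),
        ∑ i ∈ Finset.Icc 1 N, ENNReal.ofReal (p i) * ((w i).length : ℝ≥0∞) := by

  have hI : (N : ℝ) - ((r : ℝ) - 1) * ((N - 1) / (r - 1) : ℕ) = 1 := by
    have h := Nat.mul_div_cancel' hdvd
    have h2 := congrArg (Nat.cast : ℕ → ℝ) h
    rw [Nat.cast_mul, Nat.cast_sub (by omega : 1 ≤ r), Nat.cast_sub (by omega : 1 ≤ N)] at h2
    push_cast at h2 ⊢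
    linarith
  apply le_antisymm
  · refine le_iInf₂ fun w hw => ?_
    apply aux_lower N r hr p hpos hmono _ (fun k => (w k).length)
    rw [hI]
    exact aux_kraft N r hr hN α hcard w hw
  · by_cases hne : huffH N r p ((N - 1) / (r - 1)) = ⊤
    · rw [hne]; exact le_top
    obtain ⟨l, hl, hk⟩ := aux_upper N r hr p hpos _ hne
    rw [hI] at hk
    obtain ⟨w, hw, hp⟩ := aux_kraft_conv r hr α hcard l _ hk
    refine (iInf₂_le w hp).trans (le_of_eq ?_)
    rw [← hl]
    exact Finset.sum_congr rfl fun k hk => by rw [hw k hk]
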